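/- arXiv:2109.03193 — 2 statements merged into one kernel-verified Lean document; each statement's English description precedes it below -/
import Mathlib

section
/- Let A be a pointed monoid, C a Serre class of A-sets, X an A-set, and B₁, B₂ sub-A-sets of X such that both quotients X/B₁ and X/B₂ belong to C. Then X/(B₁ ∩ B₂) belongs to C. -/
universe u

/-- The setoid collapsing a subset `B` of `X` to a point. -/
def cSetoid {X : Type u} (B : Set X) : Setoid X where
  r x y := x = y ∨ (x ∈ B ∧ y ∈ B)
  iseqv := by
    refine ⟨fun x => Or.inl rfl, ?_, ?_⟩
    · rintro x y (rfl | ⟨h1, h2⟩)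
      · exact Or.inl rfl
      · exact Or.inr ⟨h2, h1⟩
    · rintro x y z (rfl | ⟨h1, h2⟩) h
      · exact h
      · rcases h with rfl | ⟨h3, h4⟩
        · exact Or.inr ⟨h1, h2⟩
        · exact Or.inr ⟨h1, h4⟩

/-- The quotient pointed set `X/B`. -/
def CQ {X : Type u} (B : Set X) : Type u := Quotient (cSetoid B)

/-- The collapse map `X → X/B`. -/
def cmk {X : Type u} (B : Set X) (x : X) : CQ B := Quotient.mk (cSetoid B) x

variable (A : Type u) [CommMonoidWithZero A]

/-- A bundled pointed `A`-set. -/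
structure ASet : Type (u + 1) where
  carrier : Type u
  pt : carrier
  act : A → carrier → carrier
  one_act : ∀ x, act 1 x = x
  mul_act : ∀ a b x, act (a * b) x = act a (act b x)
  act_pt : ∀ a, act a pt = pt
  zero_act : ∀ x, act 0 x = pt

variable {A}

/-- An isomorphism of `A`-sets: an equivariant pointed bijection. -/
def ASetIso (X Y : ASet A) : Prop :=
  ∃ e : X.carrier ≃ Y.carrier, e X.pt = Y.pt ∧ ∀ (a : A) (x : X.carrier),
    e (X.act a x) = Y.act a (e x)

/-- The product of two `A`-sets. -/
def ASet.prod (X Y : ASet A) : ASet A where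
  carrier := X.carrier × Y.carrier
  pt := (X.pt, Y.pt)
  act a p := (X.act a p.1, Y.act a p.2)
  one_act p := Prod.ext (X.one_act p.1) (Y.one_act p.2)
  mul_act a b p := Prod.ext (X.mul_act a b p.1) (Y.mul_act a b p.2)
  act_pt a := Prod.ext (X.act_pt a) (Y.act_pt a)
  zero_act p := Prod.ext (X.zero_act p.1) (Y.zero_act p.2)

/-- A sub-`A`-set of a bundled `A`-set. -/
def ASet.IsSub (X : ASet A) (S : Set X.carrier) : Prop :=
  X.pt ∈ S ∧ ∀ a : A, ∀ x ∈ S, X.act a x ∈ S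

/-- A sub-`A`-set, as an `A`-set. -/
def ASet.sub (X : ASet A) (S : Set X.carrier) (hS : X.IsSub S) : ASet A where
  carrier := S
  pt := ⟨X.pt, hS.1⟩
  act a x := ⟨X.act a x.1, hS.2 a x.1 x.2⟩
  one_act x := Subtype.ext (X.one_act x.1)
  mul_act a b x := Subtype.ext (X.mul_act a b x.1)
  act_pt a := Subtype.ext (X.act_pt a)
  zero_act x := Subtype.ext (X.zero_act x.1)

/-- The quotient `A`-set `X/S` obtained by collapsing a sub-`A`-set to the basepoint. -/
def ASet.quot (X : ASet A) (S : Set X.carrier) (hS : X.IsSub S) : ASet A where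
  carrier := CQ S
  pt := cmk S X.pt
  act a := Quotient.map (X.act a) (by
    rintro x y (rfl | ⟨h1, h2⟩)
    · exact Or.inl rfl
    · exact Or.inr ⟨hS.2 a x h1, hS.2 a y h2⟩)
  one_act q := Quotient.inductionOn q fun x => congrArg (cmk S) (X.one_act x)
  mul_act a b q := Quotient.inductionOn q fun x => congrArg (cmk S) (X.mul_act a b x)
  act_pt a := congrArg (cmk S) (X.act_pt a)
  zero_act q := Quotient.inductionOn q fun x => congrArg (cmk S) (X.zero_act x)

/-- A Serre class of `A`-sets: closed under isomorphism and finite limits (in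
particular binary products), and for every `A`-set `Y` with sub-`A`-set `S`,
`Y` belongs to the class iff both `S` and `Y/S` do. -/
structure IsSerreClass (C : ASet A → Prop) : Prop where
  iso_mem : ∀ {X Y : ASet A}, ASetIso X Y → C X → C Y
  prod_mem : ∀ {X Y : ASet A}, C X → C Y → C (X.prod Y)
  serre : ∀ (Y : ASet A) (S : Set Y.carrier) (hS : Y.IsSub S),
    C Y ↔ C (Y.sub S hS) ∧ C (Y.quot S hS)

/-- A Serre class contains every `A`-set that embeds equivariantly into one of its members. -/
theorem IsSerreClass.mem_of_injective {C : ASet A → Prop} (hC : IsSerreClass C) {X Y : ASet A}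
    (f : X.carrier → Y.carrier) (hf : Function.Injective f) (hpt : f X.pt = Y.pt)
    (hact : ∀ a x, f (X.act a x) = Y.act a (f x)) (hY : C Y) : C X := by
  have hS : Y.IsSub (Set.range f) := by
    refine ⟨⟨X.pt, hpt⟩, ?_⟩
    rintro a _ ⟨x, rfl⟩
    exact ⟨X.act a x, hact a x⟩
  let e : X.carrier ≃ (Y.sub _ hS).carrier := Equiv.ofInjective f hf
  refine hC.iso_mem ⟨e.symm, ?_, fun a y => ?_⟩ ((hC.serre Y _ hS).1 hY).1
  · exact e.symm_apply_eq.2 (Subtype.ext hpt.symm)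
  · obtain ⟨x, rfl⟩ := e.surjective y
    rw [e.symm_apply_apply, e.symm_apply_eq]
    exact Subtype.ext (hact a x).symm

theorem cmk_eq_iff {X : Type u} {B : Set X} {x y : X} :
    cmk B x = cmk B y ↔ x = y ∨ (x ∈ B ∧ y ∈ B) :=
  Quotient.eq (r := cSetoid B)

/-- The map `X/(B₁ ∩ B₂) → X/B₁ × X/B₂` induced by the two collapse maps. -/
def interToProd {X : Type u} (B₁ B₂ : Set X) : CQ (B₁ ∩ B₂) → CQ B₁ × CQ B₂ :=
  Quotient.lift (fun x => (cmk B₁ x, cmk B₂ x)) fun _ _ h => Prod.ext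
    (cmk_eq_iff.2 (h.imp_right fun h => ⟨h.1.1, h.2.1⟩))
    (cmk_eq_iff.2 (h.imp_right fun h => ⟨h.1.2, h.2.2⟩))

theorem interToProd_injective {X : Type u} (B₁ B₂ : Set X) :
    Function.Injective (interToProd B₁ B₂) := by
  rintro ⟨x⟩ ⟨y⟩ h
  obtain ⟨h₁, h₂⟩ := Prod.ext_iff.1 h
  refine cmk_eq_iff.2 ?_
  rcases cmk_eq_iff.1 h₁ with h₁ | h₁
  · exact Or.inl h₁
  · exact (cmk_eq_iff.1 h₂).imp_right fun h₂ => ⟨⟨h₁.1, h₂.1⟩, ⟨h₁.2, h₂.2⟩⟩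

/-- STATEMENT 12: if `C` is a Serre class of `A`-sets and `B₁, B₂` are sub-`A`-sets of
`X` with both `X/B₁` and `X/B₂` in `C`, then `X/(B₁ ∩ B₂)` is in `C`. -/
theorem stmt12 (C : ASet A → Prop) (hC : IsSerreClass C)
    (X : ASet A) (B₁ B₂ : Set X.carrier)
    (h₁ : X.IsSub B₁) (h₂ : X.IsSub B₂) (h₁₂ : X.IsSub (B₁ ∩ B₂))
    (hq₁ : C (X.quot B₁ h₁)) (hq₂ : C (X.quot B₂ h₂)) :
    C (X.quot (B₁ ∩ B₂) h₁₂) := by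
  refine hC.mem_of_injective (Y := (X.quot B₁ h₁).prod (X.quot B₂ h₂)) (interToProd B₁ B₂)
    (interToProd_injective B₁ B₂) rfl ?_ (hC.prod_mem hq₁ hq₂)
  rintro a ⟨x⟩
  rfl
end

section
/- Let A be a pointed monoid, let i : B → X be an injective map of A-sets, and let f : B → Y be any map of A-sets. Then the pushout P of X and Y along B exists in the category of A-sets, the canonical map Y → P is injective, and the pushout square B → X, B → Y, X → P, Y → P is also a pullback square. (This verifies axiom (A1) of an adherent category for the category of A-sets.) -/
/-- The pushout of `X` and `Y` along an injection `i : B → X` and `f : B → Y`: the image of `i` is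
replaced by `Y`. -/
abbrev ASetPushout {B X : Type u} (Y : Type u) (i : B → X) : Type u :=
  Y ⊕ {x : X // x ∉ Set.range i}

namespace ASetPushout

variable {B X Y : Type u}

open Classical in
/-- The canonical map from `X` to the pushout. -/
noncomputable def ofLeft (i : B → X) (f : B → Y) (x : X) : ASetPushout Y i :=
  if h : x ∈ Set.range i then .inl (f h.choose) else .inr ⟨x, h⟩

/-- The induced action on the pushout. -/
noncomputable def act (actX : A → X → X) (actY : A → Y → Y) (i : B → X) (f : B → Y) (a : A) :
    ASetPushout Y i → ASetPushout Y i :=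
  Sum.elim (fun y => .inl (actY a y)) (fun x => ofLeft i f (actX a x))

theorem ofLeft_apply {i : B → X} (hi : Function.Injective i) (f : B → Y) (b : B) :
    ofLeft i f (i b) = .inl (f b) := by
  have h : i b ∈ Set.range i := ⟨b, rfl⟩
  rw [ofLeft, dif_pos h, hi h.choose_spec]

theorem ofLeft_of_notMem {i : B → X} (f : B → Y) {x : X} (h : x ∉ Set.range i) :
    ofLeft i f x = .inr ⟨x, h⟩ :=
  dif_neg h

theorem ofLeft_eq_inl_iff {i : B → X} (hi : Function.Injective i) (f : B → Y) {x : X} {y : Y} :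
    ofLeft i f x = .inl y ↔ ∃ b, i b = x ∧ f b = y := by
  constructor
  · intro h
    by_cases hx : x ∈ Set.range i
    · obtain ⟨b, rfl⟩ := hx
      rw [ofLeft_apply hi] at h
      exact ⟨b, rfl, Sum.inl.inj h⟩
    · rw [ofLeft_of_notMem f hx] at h
      cases h
  · rintro ⟨b, rfl, rfl⟩
    exact ofLeft_apply hi f b

/-- Every element of the pushout comes from `X` or from `Y`. -/
theorem induction_on {i : B → X} (f : B → Y) {motive : ASetPushout Y i → Prop}
    (left : ∀ x, motive (ofLeft i f x)) (right : ∀ y, motive (.inl y)) (p : ASetPushout Y i) :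
    motive p := by
  rcases p with y | ⟨x, hx⟩
  · exact right y
  · simpa only [ofLeft_of_notMem f hx] using left x

theorem act_ofLeft {actB : A → B → B} {actX : A → X → X} {actY : A → Y → Y} {i : B → X} {f : B → Y}
    (hi : ∀ a b, i (actB a b) = actX a (i b)) (hiInj : Function.Injective i)
    (hf : ∀ a b, f (actB a b) = actY a (f b)) (a : A) (x : X) :
    act actX actY i f a (ofLeft i f x) = ofLeft i f (actX a x) := by
  by_cases hx : x ∈ Set.range i
  · obtain ⟨b, rfl⟩ := hx
    rw [← hi, ofLeft_apply hiInj, ofLeft_apply hiInj, hf]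
    rfl
  · rw [ofLeft_of_notMem f hx]
    rfl

end ASetPushout


universe u

variable {A : Type u} [CommMonoidWithZero A]

/-- `(act, star)` makes `X` a pointed `A`-set. -/
def IsASetAct {X : Type u} (act : A → X → X) (star : X) : Prop :=
  (∀ x, act 1 x = x) ∧ (∀ a b x, act (a * b) x = act a (act b x)) ∧
  (∀ a, act a star = star) ∧ (∀ x, act 0 x = star)

/-- A map of pointed `A`-sets: basepoint-preserving and equivariant. -/
def IsASetHom {X Y : Type u} (actX : A → X → X) (xs : X)
    (actY : A → Y → Y) (ys : Y) (f : X → Y) : Prop :=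
  f xs = ys ∧ ∀ (a : A) (x : X), f (actX a x) = actY a (f x)

/-- STATEMENT 14: for an injective map `i : B → X` of `A`-sets and an arbitrary map
`f : B → Y` of `A`-sets, the pushout `P` of `X` and `Y` along `B` exists in the
category of `A`-sets, the canonical map `Y → P` is injective, and the pushout square
is also a pullback square (axiom (A1) for `A`-sets). -/
theorem stmt14 {B X Y : Type u}
    (actB : A → B → B) (bs : B) (hB : IsASetAct actB bs)
    (actX : A → X → X) (xs : X) (hX : IsASetAct actX xs)
    (actY : A → Y → Y) (ys : Y) (hY : IsASetAct actY ys)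
    (i : B → X) (hi : IsASetHom actB bs actX xs i) (hiInj : Function.Injective i)
    (f : B → Y) (hf : IsASetHom actB bs actY ys f) :
    ∃ (P : Type u) (actP : A → P → P) (ps : P) (u : X → P) (v : Y → P),
      IsASetAct actP ps ∧
      IsASetHom actX xs actP ps u ∧
      IsASetHom actY ys actP ps v ∧
      (∀ b : B, u (i b) = v (f b)) ∧
      Function.Injective v ∧
      (∀ (T : Type u) (actT : A → T → T) (ts : T), IsASetAct actT ts →
        ∀ (g : X → T) (h : Y → T),
          IsASetHom actX xs actT ts g → IsASetHom actY ys actT ts h →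
          (∀ b : B, g (i b) = h (f b)) →
          ∃! k : P → T, IsASetHom actP ps actT ts k ∧
            (∀ x : X, k (u x) = g x) ∧ (∀ y : Y, k (v y) = h y)) ∧
      (∀ (x : X) (y : Y), u x = v y → ∃! b : B, i b = x ∧ f b = y) := by
  have hl := ASetPushout.act_ofLeft hi.2 hiInj hf.2
  have hb := ASetPushout.ofLeft_apply hiInj f
  have hs : ASetPushout.ofLeft i f xs = .inl ys := by rw [← hi.1, hb, hf.1]
  refine ⟨ASetPushout Y i, ASetPushout.act actX actY i f, .inl ys, ASetPushout.ofLeft i f, .inl,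
    ⟨?_, ?_, ?_, ?_⟩, ⟨hs, fun a x => (hl a x).symm⟩, ⟨rfl, fun _ _ => rfl⟩, hb,
    Sum.inl_injective, ?_, ?_⟩
  · refine ASetPushout.induction_on f (fun x => ?_) (fun y => ?_)
    · rw [hl, hX.1]
    · exact congrArg Sum.inl (hY.1 y)
  · intro a b
    refine ASetPushout.induction_on f (fun x => ?_) (fun y => ?_)
    · simp only [hl, hX.2.1]
    · exact congrArg Sum.inl (hY.2.1 a b y)
  · exact fun a => congrArg Sum.inl (hY.2.2.1 a)
  · refine ASetPushout.induction_on f (fun x => ?_) (fun y => ?_)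
    · rw [hl, hX.2.2.2, hs]
    · exact congrArg Sum.inl (hY.2.2.2 y)
  · intro T actT ts _ g h hg hh hgh
    let k : ASetPushout Y i → T := Sum.elim h (fun x => g x)
    have hk (x : X) : k (ASetPushout.ofLeft i f x) = g x := by
      by_cases hx : x ∈ Set.range i
      · obtain ⟨b, rfl⟩ := hx
        rw [hb, hgh]
        rfl
      · rw [ASetPushout.ofLeft_of_notMem f hx]
        rfl
    refine ⟨k, ⟨⟨hh.1, fun a => ?_⟩, hk, fun _ => rfl⟩, ?_⟩
    · refine ASetPushout.induction_on f (fun x => ?_) (hh.2 a)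
      rw [hl, hk, hk, hg.2]
    · rintro k' ⟨-, hx, hy⟩
      funext p
      exact ASetPushout.induction_on f (motive := fun p => k' p = k p)
        (fun x => (hx x).trans (hk x).symm) hy p
  · intro x y hxy
    obtain ⟨b, rfl, hy⟩ := (ASetPushout.ofLeft_eq_inl_iff hiInj f).1 hxy
    exact ⟨b, ⟨rfl, hy⟩, fun _ hb' => hiInj hb'.1⟩
end
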